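/- arXiv:1606.07476 — 5 statements merged into one kernel-verified Lean document; each statement's English description precedes it below -/
import Mathlib

section
/- Let (X,b,m) be a connected weighted graph satisfying (B) and (M). Then the metric space (X,d) is locally compact and complete. -/
/-! Basic notions for a weighted graph `(X, b, m)`:
`b : X × X → [0,∞)` is a symmetric edge weight, `m : X → (0,∞)` a vertex measure.
Paths, path lengths, the induced path metric `graphDist`, the energy form,
`ℓ²(X,m)`, volumes, inradius and covering radius. -/

variable {X : Type*}

/-- A path in the weighted graph: a nonempty list of vertices with positive
edge weight between consecutive vertices. -/
def IsPath (b : X → X → ℝ) (γ : List X) : Prop :=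
  γ ≠ [] ∧ γ.Chain' fun u v => 0 < b u v

/-- A path from `x` to `y`. -/
def IsPathFrom (b : X → X → ℝ) (γ : List X) (x y : X) : Prop :=
  IsPath b γ ∧ γ.head? = some x ∧ γ.getLast? = some y

/-- The length of a path: the sum of the reciprocals of the edge weights
of its edges. -/
noncomputable def pathLength (b : X → X → ℝ) : List X → ℝ
  | [] => 0
  | [_] => 0
  | u :: v :: rest => 1 / b u v + pathLength b (v :: rest)

/-- The induced path metric: `d(x,y)` is the infimum of the lengths of paths
from `x` to `y`. -/
noncomputable def graphDist (b : X → X → ℝ) (x y : X) : ℝ :=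
  sInf {L | ∃ γ, IsPathFrom b γ x y ∧ L = pathLength b γ}

/-- The energy form `E(f,f) = (1/2) ∑_{x,y} b(x,y) (f(x) - f(y))²`. -/
noncomputable def energy (b : X → X → ℝ) (f : X → ℝ) : ℝ :=
  (1 / 2) * ∑' p : X × X, b p.1 p.2 * (f p.1 - f p.2) ^ 2

/-- The squared norm in `ℓ²(X,m)`. -/
noncomputable def l2norm (m : X → ℝ) (f : X → ℝ) : ℝ := ∑' x, f x ^ 2 * m x

/-- Membership in `ℓ²(X,m)`. -/
def MemL2 (m : X → ℝ) (f : X → ℝ) : Prop := Summable fun x => f x ^ 2 * m x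

/-- The volume of a subset `A ⊆ X`: `vol(A) = ∑_{x ∈ A} m(x)`. -/
noncomputable def vol (m : X → ℝ) (A : Set X) : ℝ := ∑' x : A, m (x : X)

/-- The inradius `Inr(Ω) = sup {r > 0 : ∃ x ∈ Ω, U_r(x) ⊆ Ω}`. -/
noncomputable def inradius (b : X → X → ℝ) (Ω : Set X) : ℝ :=
  sSup {r | 0 < r ∧ ∃ x ∈ Ω, ∀ y, graphDist b x y < r → y ∈ Ω}

/-- The covering radius `Covr(D) = inf {R > 0 : ⋃_{p ∈ D} B_R(p) = X}`. -/
noncomputable def covRad (b : X → X → ℝ) (D : Set X) : ℝ :=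
  sInf {R | 0 < R ∧ ∀ x, ∃ p ∈ D, graphDist b p x ≤ R}

/-- `D` is relatively dense iff its covering radius is finite, i.e. some
`R > 0` works. -/
def RelDense (b : X → X → ℝ) (D : Set X) : Prop :=
  {R : ℝ | 0 < R ∧ ∀ x, ∃ p ∈ D, graphDist b p x ≤ R}.Nonempty

/-- `vol[s] = sup_{x ∈ X} vol(B_s(x))`. -/
noncomputable def supVolBall (b : X → X → ℝ) (m : X → ℝ) (s : ℝ) : ℝ :=
  ⨆ x : X, vol m {y | graphDist b x y ≤ s}

theorem pathLength_nonneg_aux (b : X → X → ℝ) (hb : ∀ x y, 0 ≤ b x y) :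
    ∀ γ : List X, 0 ≤ pathLength b γ
  | [] => le_rfl
  | [_] => le_rfl
  | u :: v :: rest => by
    have h := pathLength_nonneg_aux b hb (v :: rest)
    have h2 : 0 ≤ 1 / b u v := one_div_nonneg.2 (hb u v)
    simp only [pathLength]
    linarith

/-- Proposition 2.1 (b). For a connected weighted graph
satisfying (B) and (M), the metric space `(X,d)` (where `d` is the induced
path metric `graphDist b`) is locally compact and complete. -/
theorem statement_2 {X : Type*} [Countable X] [Nonempty X] [MetricSpace X]
    (b : X → X → ℝ) (m : X → ℝ)
    (hb_symm : ∀ x y, b x y = b y x) (hb_nonneg : ∀ x y, 0 ≤ b x y)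
    (hb_diag : ∀ x, b x x = 0) (hb_sum : ∀ x, Summable fun y => b x y)
    (hm_pos : ∀ x, 0 < m x)
    (hconn : ∀ x y, ∃ γ, IsPathFrom b γ x y)
    (hB : BddAbove (Set.range fun x => (∑' y, b x y) / m x))
    (hM : BddAbove (Set.range m))
    (hdist : ∀ x y, dist x y = graphDist b x y) :
    LocallyCompactSpace X ∧ CompleteSpace X := by
  obtain ⟨δ, hδ⟩ := hB
  obtain ⟨M, hM⟩ := hM
  have hle : ∀ x y, b x y ≤ |δ| * |M| + 1 := by
    intro x y
    have h1 : b x y ≤ ∑' z, b x z := (hb_sum x).le_tsum y (fun z _ => hb_nonneg x z)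
    have h2 : (∑' z, b x z) / m x ≤ δ := hδ ⟨x, rfl⟩
    have h3 : m x ≤ M := hM ⟨x, rfl⟩
    rw [div_le_iff₀ (hm_pos x)] at h2
    have h4 : δ * m x ≤ |δ| * |M| :=
      mul_le_mul (le_abs_self δ) (h3.trans (le_abs_self M)) (hm_pos x).le (abs_nonneg δ)
    linarith
  have hC : 0 < |δ| * |M| + 1 := by positivity
  have hr : 0 < 1 / (|δ| * |M| + 1) := by positivity
  have hsep : Pairwise fun x y : X => 1 / (|δ| * |M| + 1) ≤ dist x y := by
    intro x y hxy
    rw [hdist]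
    refine le_csInf ?_ ?_
    · obtain ⟨γ, hγ⟩ := hconn x y
      exact ⟨_, γ, hγ, rfl⟩
    · rintro L ⟨γ, ⟨⟨hne, hch⟩, hh, hl⟩, rfl⟩
      match γ, hne, hch, hh, hl with
      | [], hne, _, _, _ => exact absurd rfl hne
      | [u], _, _, hh, hl =>
        simp at hh hl
        exact absurd (hh.symm.trans hl) hxy
      | u :: v :: rest, _, hch, _, _ =>
        have huv : 0 < b u v := (List.isChain_cons_cons.1 hch).1
        have h1 : 1 / (|δ| * |M| + 1) ≤ 1 / b u v :=
          one_div_le_one_div_of_le huv (hle u v)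
        have h2 := pathLength_nonneg_aux b hb_nonneg (v :: rest)
        simp only [pathLength]
        linarith
  have hdu : DiscreteUniformity X := ⟨Metric.uniformSpace_eq_bot.2 ⟨_, hr, hsep⟩⟩
  exact ⟨inferInstance, inferInstance⟩
end

section
/- Let (X,b,m) be a connected weighted graph satisfying (B) and (M). Then for every r ≥ 0 and every x ∈ X, the closed ball B_r(x) is finite with cardinality #B_r(x) ≤ (r·δ·m_max)^{r·b_max} + 1. In particular, condition (V) holds: sup_{x∈X} vol(B_r(x)) < ∞ for every r ≥ 0. -/
/-! Basic notions for a weighted graph `(X, b, m)`: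
`b : X × X → [0,∞)` is a symmetric edge weight, `m : X → (0,∞)` a vertex measure.
Paths, path lengths, the induced path metric `graphDist`, the energy form,
`ℓ²(X,m)`, volumes, inradius and covering radius. -/

variable {X : Type*}

open Classical in
/-- Iterated neighbourhoods of `x`. -/
noncomputable def nbhd {X : Type*} (W : X → Finset X) (x : X) : ℕ → Finset X
  | 0 => {x}
  | k + 1 => nbhd W x k ∪ (nbhd W x k).biUnion W

theorem nbhd_mono {X : Type*} (W : X → Finset X) (x : X) : Monotone (nbhd W x) := by
  classical
  apply monotone_nat_of_le_succ
  intro n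
  simp only [nbhd]
  exact Finset.subset_union_left

theorem nbhd_step {X : Type*} (W : X → Finset X) (x : X) {k : ℕ} {u v : X}
    (hu : u ∈ nbhd W x k) (hv : v ∈ W u) : v ∈ nbhd W x (k + 1) := by
  classical
  simp only [nbhd, Finset.mem_union, Finset.mem_biUnion]
  exact Or.inr ⟨u, hu, hv⟩

theorem nbhd_empty {X : Type*} (W : X → Finset X) (x : X) (hW : ∀ u, (W u).card ≤ 0) (k : ℕ) :
    nbhd W x k = {x} := by
  classical
  induction k with
  | zero => rfl
  | succ k ih =>
    have h : ∀ u, W u = ∅ := fun u => by simpa using hW u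
    simp [nbhd, ih, h]

open Classical in
theorem layer_card {X : Type*} (W : X → Finset X) (x : X) (N : ℕ)
    (hsymm : ∀ u v, v ∈ W u → u ∈ W v) (hW : ∀ u, (W u).card ≤ N) (k : ℕ) :
    (nbhd W x (k + 2) \ nbhd W x (k + 1)).card ≤
      (nbhd W x (k + 1) \ nbhd W x k).card * (N - 1) := by
  have hsub : nbhd W x (k + 2) \ nbhd W x (k + 1) ⊆
      (nbhd W x (k + 1) \ nbhd W x k).biUnion (fun z => W z \ nbhd W x k) := by
    intro y hy
    rw [Finset.mem_sdiff] at hy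
    obtain ⟨h1, h2⟩ := hy
    have h3 : y ∈ nbhd W x (k + 1) ∪ (nbhd W x (k + 1)).biUnion W := h1
    simp only [Finset.mem_union, Finset.mem_biUnion] at h3
    rcases h3 with h3 | ⟨z, hz, hyz⟩
    · exact absurd h3 h2
    · simp only [Finset.mem_biUnion, Finset.mem_sdiff]
      refine ⟨z, ⟨hz, fun hz' => h2 (nbhd_step W x hz' hyz)⟩, hyz,
        fun h => h2 (nbhd_mono W x (Nat.le_succ k) h)⟩
  refine (Finset.card_le_card hsub).trans ?_
  apply Finset.card_biUnion_le_card_mul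
  intro z hz
  rw [Finset.mem_sdiff] at hz
  have h3 : z ∈ nbhd W x k ∪ (nbhd W x k).biUnion W := hz.1
  simp only [Finset.mem_union, Finset.mem_biUnion] at h3
  rcases h3 with h3 | ⟨w, hw, hzw⟩
  · exact absurd h3 hz.2
  · have hlt : (W z \ nbhd W x k).card < (W z).card := by
      apply Finset.card_lt_card
      refine Finset.ssubset_iff_subset_ne.2 ⟨Finset.sdiff_subset, fun h => ?_⟩
      have : w ∈ W z \ nbhd W x k := by
        rw [h]
        exact hsymm _ _ hzw
      exact (Finset.mem_sdiff.1 this).2 hw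
    have := hW z
    omega

theorem nbhd_card {X : Type*} (W : X → Finset X) (x : X) (n : ℕ)
    (hsymm : ∀ u v, v ∈ W u → u ∈ W v) (hW : ∀ u, (W u).card ≤ n + 1) (k : ℕ) :
    (nbhd W x (k + 1)).card + n ≤ n + 1 + 1 + n * (nbhd W x k).card ∧
    (nbhd W x (k + 1)).card ≤ (n + 1) ^ (k + 1) + 1 := by
  classical
  have h1 : (nbhd W x 1).card ≤ n + 1 + 1 := by
    have : nbhd W x 1 = {x} ∪ W x := by simp [nbhd]
    rw [this]
    have := Finset.card_union_le {x} (W x)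
    have := hW x
    simp at *
    omega
  induction k with
  | zero =>
    have : (nbhd W x 0).card = 1 := by simp [nbhd]
    rw [this]
    simp at *
    omega
  | succ k ih =>
    obtain ⟨ih1, ih2⟩ := ih
    have hl := layer_card W x (n + 1) hsymm hW k
    have c1 := Finset.card_sdiff_add_card_eq_card (nbhd_mono W x (Nat.le_succ (k + 1)))
    have c2 := Finset.card_sdiff_add_card_eq_card (nbhd_mono W x (Nat.le_succ k))
    simp only [Nat.succ_eq_add_one, Nat.add_sub_cancel] at *
    have key : (nbhd W x (k + 1 + 1)).card + n ≤ n + 1 + 1 + n * (nbhd W x (k + 1)).card := by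
      have : k + 1 + 1 = k + 2 := rfl
      rw [this] at *
      nlinarith
    refine ⟨key, ?_⟩
    have h2 : n * (nbhd W x (k + 1)).card ≤ n * ((n + 1) ^ (k + 1) + 1) :=
      Nat.mul_le_mul_left _ ih2
    have h3 : n + 1 ≤ (n + 1) ^ (k + 1) := Nat.le_self_pow (by omega) _
    have h4 : (n + 1) ^ (k + 1 + 1) = (n + 1) ^ (k + 1) * n + (n + 1) ^ (k + 1) := by ring
    nlinarith

theorem pathLength_nonneg {X : Type*} (b : X → X → ℝ) (hb : ∀ x y, 0 ≤ b x y) (γ : List X) :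
    0 ≤ pathLength b γ := by
  induction γ with
  | nil => simp [pathLength]
  | cons u l ih =>
    cases l with
    | nil => simp [pathLength]
    | cons v l =>
      simp only [pathLength]
      have := hb u v
      positivity

theorem path_nbhd {X : Type*} (b : X → X → ℝ) (hb : ∀ x y, 0 ≤ b x y) (W : X → Finset X) (x : X)
    (ρ c : ℝ) (hW : ∀ u v, 0 < b u v → 1 / b u v ≤ ρ → v ∈ W u) (hc : ∀ u v, b u v ≤ c)
    (l : List X) : ∀ (u : X) (j : ℕ) (y : X), u ∈ nbhd W x j →
      (u :: l).IsChain (fun u v => 0 < b u v) →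
      pathLength b (u :: l) ≤ ρ → (u :: l).getLast? = some y →
      y ∈ nbhd W x (j + l.length) ∧ (l.length : ℝ) ≤ pathLength b (u :: l) * c := by
  induction l with
  | nil =>
    intro u j y hu _ _ hy
    simp at hy
    subst hy
    simpa [pathLength] using hu
  | cons v l ih =>
    intro u j y hu hch hL hy
    rw [List.isChain_cons_cons] at hch
    simp only [pathLength] at hL ⊢
    have h0 := pathLength_nonneg b hb (v :: l)
    have hpos : 0 < 1 / b u v := by have := hch.1; positivity
    have hv : v ∈ W u := hW u v hch.1 (by linarith)
    obtain ⟨a1, a2⟩ := ih v (j + 1) y (nbhd_step W x hu hv) hch.2 (by linarith)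
      (by simpa [List.getLast?_cons_cons] using hy)
    refine ⟨?_, ?_⟩
    · rw [List.length_cons]
      convert a1 using 2
      omega
    · have : 1 ≤ 1 / b u v * c := by
        have := hch.1
        rw [one_div_mul_eq_div, le_div_iff₀ this]
        linarith [hc u v]
      push_cast [List.length_cons]
      linarith

/-- Vertices reachable by a path of length at most `ρ`. -/
theorem path_ball {X : Type*} (b : X → X → ℝ)
    (hb_symm : ∀ x y, b x y = b y x) (hb_nonneg : ∀ x y, 0 ≤ b x y)
    (hb_sum : ∀ x, Summable fun y => b x y) (M c : ℝ)
    (hM : ∀ x, ∑' y, b x y ≤ M) (hc : ∀ x y, b x y ≤ c) (hM0 : 0 ≤ M) (hc0 : 0 ≤ c)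
    (ρ : ℝ) (hρ : 0 < ρ) (x : X) :
    ∃ S : Finset X, (∀ y γ, IsPathFrom b γ x y → pathLength b γ ≤ ρ → y ∈ S) ∧
      (S.card : ℝ) ≤ (ρ * M) ^ (ρ * c) + 1 ∧ (ρ * M < 1 → S.card ≤ 1) := by
  classical
  have hfin : ∀ u, {v | 1 / ρ ≤ b u v}.Finite := by
    intro u
    have h := (hb_sum u).tendsto_cofinite_zero.eventually_lt_const (show 0 < 1 / ρ by positivity)
    rw [Filter.eventually_cofinite] at h
    simpa using h
  let W : X → Finset X := fun u => (hfin u).toFinset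
  have hWm : ∀ u v, v ∈ W u ↔ 1 / ρ ≤ b u v := by intro u v; simp [W]
  have hWsymm : ∀ u v, v ∈ W u → u ∈ W v := by
    intro u v h
    rw [hWm] at *
    rwa [hb_symm]
  have hWc : ∀ u, (W u).card ≤ ⌊ρ * M⌋₊ := by
    intro u
    apply Nat.le_floor
    have h1 := Finset.card_nsmul_le_sum (W u) (fun v => b u v) (1 / ρ) (fun v hv => (hWm u v).1 hv)
    have h2 := (hb_sum u).sum_le_tsum (W u) (fun v _ => hb_nonneg u v)
    have h3 : ((W u).card : ℝ) * (1 / ρ) ≤ M := by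
      rw [nsmul_eq_mul] at h1
      exact h1.trans (h2.trans (hM u))
    rw [mul_one_div, div_le_iff₀ hρ] at h3
    linarith
  have hρM : 0 ≤ ρ * M := by positivity
  have hsmall : ρ * M < 1 → (nbhd W x ⌊ρ * c⌋₊).card ≤ 1 := by
    intro h
    rw [Nat.floor_eq_zero.2 h] at hWc
    rw [nbhd_empty W x hWc]
    simp
  refine ⟨nbhd W x ⌊ρ * c⌋₊, ?_, ?_, hsmall⟩
  · rintro y γ ⟨⟨hne, hch⟩, hh, hl⟩ hL
    cases γ with
    | nil => exact absurd rfl hne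
    | cons u l =>
      simp at hh
      subst hh
      obtain ⟨a1, a2⟩ := path_nbhd b hb_nonneg W u ρ c (fun p q hpq h => by
        rw [hWm]
        rw [div_le_iff₀ hpq] at h
        rw [div_le_iff₀ hρ]
        linarith) hc l u 0 y (by simp [nbhd]) hch hL hl
      refine nbhd_mono W u ?_ a1
      rw [zero_add]
      apply Nat.le_floor
      exact a2.trans (mul_le_mul_of_nonneg_right hL hc0)
  · have hp : 0 ≤ (ρ * M) ^ (ρ * c) := Real.rpow_nonneg hρM _
    rcases lt_or_ge (ρ * M) 1 with h | h
    · have : ((nbhd W x ⌊ρ * c⌋₊).card : ℝ) ≤ 1 := by exact_mod_cast hsmall h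
      linarith
    · rcases hk : ⌊ρ * c⌋₊ with _ | k
      · simp [nbhd, hp]
      · have hN : 1 ≤ ⌊ρ * M⌋₊ := by
          apply Nat.le_floor
          simpa using h
        obtain ⟨n, hn⟩ := Nat.exists_eq_add_of_le' hN
        rw [hn] at hWc
        have h1 := (nbhd_card W x n hWsymm hWc k).2
        have h2 : ((nbhd W x (k + 1)).card : ℝ) ≤ ((n + 1 : ℕ) : ℝ) ^ (k + 1) + 1 := by
          exact_mod_cast h1
        have h3 : ((n + 1 : ℕ) : ℝ) ≤ ρ * M := by
          rw [← hn]
          exact Nat.floor_le hρM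
        have h4 : ((n + 1 : ℕ) : ℝ) ^ (k + 1) ≤ (ρ * M) ^ (k + 1) :=
          pow_le_pow_left₀ (by positivity) h3 _
        have h5 : (ρ * M) ^ (k + 1) ≤ (ρ * M) ^ (ρ * c) := by
          rw [← Real.rpow_natCast]
          apply Real.rpow_le_rpow_of_exponent_le h
          rw [← hk]
          exact Nat.floor_le (by positivity)
        linarith

theorem ball_bound {X : Type*} (b : X → X → ℝ)
    (hb_symm : ∀ x y, b x y = b y x) (hb_nonneg : ∀ x y, 0 ≤ b x y)
    (hb_sum : ∀ x, Summable fun y => b x y)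
    (hconn : ∀ x y, ∃ γ, IsPathFrom b γ x y) (M c : ℝ)
    (hM : ∀ x, ∑' y, b x y ≤ M) (hc : ∀ x y, b x y ≤ c) (hM0 : 0 ≤ M) (hc0 : 0 ≤ c)
    (r : ℝ) (hr : 0 ≤ r) (x : X) :
    {y | graphDist b x y ≤ r}.Finite ∧
      ({y | graphDist b x y ≤ r}.ncard : ℝ) ≤ (r * M) ^ (r * c) + 1 := by
  have key : ∀ ρ, r < ρ → ∃ S : Finset X, {y | graphDist b x y ≤ r} ⊆ (S : Set X) ∧
      (S.card : ℝ) ≤ (ρ * M) ^ (ρ * c) + 1 ∧ (ρ * M < 1 → S.card ≤ 1) := by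
    intro ρ hρ
    obtain ⟨S, h1, h2⟩ := path_ball b hb_symm hb_nonneg hb_sum M c hM hc hM0 hc0 ρ
      (by linarith) x
    refine ⟨S, ?_, h2⟩
    intro y hy
    have hne : {L | ∃ γ, IsPathFrom b γ x y ∧ L = pathLength b γ}.Nonempty := by
      obtain ⟨γ, hγ⟩ := hconn x y
      exact ⟨_, γ, hγ, rfl⟩
    obtain ⟨L, ⟨γ, hγ, rfl⟩, hlt⟩ := exists_lt_of_csInf_lt hne (lt_of_le_of_lt hy hρ)
    exact h1 y γ hγ hlt.le
  have keyc : ∀ ρ, r < ρ → ({y | graphDist b x y ≤ r}.ncard : ℝ) ≤ (ρ * M) ^ (ρ * c) + 1 ∧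
      (ρ * M < 1 → {y | graphDist b x y ≤ r}.ncard ≤ 1) := by
    intro ρ hρ
    obtain ⟨S, h1, h2, h3⟩ := key ρ hρ
    have h4 : {y | graphDist b x y ≤ r}.ncard ≤ S.card := by
      have := Set.ncard_le_ncard h1 S.finite_toSet
      rwa [Set.ncard_coe_finset] at this
    exact ⟨le_trans (by exact_mod_cast h4) h2, fun h => h4.trans (h3 h)⟩
  refine ⟨?_, ?_⟩
  · obtain ⟨S, h1, _⟩ := key (r + 1) (by linarith)
    exact S.finite_toSet.subset h1
  · have hrM : 0 ≤ r * M := by positivity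
    rcases hrM.eq_or_lt with h0 | hpos
    · have h1 : r < r + 1 / (M + 1) := by
        have : 0 < 1 / (M + 1) := by positivity
        linarith
      have h2 : (r + 1 / (M + 1)) * M < 1 := by
        rw [add_mul, ← h0, zero_add, one_div_mul_eq_div, div_lt_one (by linarith)]
        linarith
      have h3 : ({y | graphDist b x y ≤ r}.ncard : ℝ) ≤ 1 := by
        exact_mod_cast (keyc _ h1).2 h2
      have := Real.rpow_nonneg hrM (r * c)
      linarith
    · have hcont : ContinuousAt (fun ρ : ℝ => (ρ * M) ^ (ρ * c) + 1) r := by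
        apply ContinuousAt.add _ continuousAt_const
        exact ContinuousAt.rpow (by fun_prop) (by fun_prop) (Or.inl hpos.ne')
      have ht : Filter.Tendsto (fun ρ : ℝ => (ρ * M) ^ (ρ * c) + 1) (nhdsWithin r (Set.Ioi r))
          (nhds ((r * M) ^ (r * c) + 1)) := hcont.tendsto.mono_left nhdsWithin_le_nhds
      apply ge_of_tendsto ht
      filter_upwards [self_mem_nhdsWithin] with ρ hρ
      exact (keyc ρ hρ).1

/-- Proposition 2.1 (c). For a connected weighted graph
satisfying (B) and (M), for every `r ≥ 0` and every `x`, the closed ball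
`B_r(x)` is finite with `#B_r(x) ≤ (r δ m_max)^(r b_max) + 1` (real power),
where `δ = sup_x (1/m(x)) ∑_y b(x,y)`, `m_max = sup m`, `b_max = sup b`.
In particular (V) holds: `sup_x vol(B_r(x)) < ∞` for all `r ≥ 0`. -/
theorem statement_3 {X : Type*} [Countable X] [Nonempty X]
    (b : X → X → ℝ) (m : X → ℝ)
    (hb_symm : ∀ x y, b x y = b y x) (hb_nonneg : ∀ x y, 0 ≤ b x y)
    (hb_diag : ∀ x, b x x = 0) (hb_sum : ∀ x, Summable fun y => b x y)
    (hm_pos : ∀ x, 0 < m x)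
    (hconn : ∀ x y, ∃ γ, IsPathFrom b γ x y)
    (hB : BddAbove (Set.range fun x => (∑' y, b x y) / m x))
    (hM : BddAbove (Set.range m)) :
    (∀ r : ℝ, 0 ≤ r → ∀ x : X,
      {y | graphDist b x y ≤ r}.Finite ∧
      ({y | graphDist b x y ≤ r}.ncard : ℝ) ≤
        (r * (⨆ x : X, (∑' y, b x y) / m x) * (⨆ x : X, m x)) ^
          (r * ⨆ p : X × X, b p.1 p.2) + 1) ∧
    ∀ r : ℝ, 0 ≤ r → BddAbove (Set.range fun x => vol m {y | graphDist b x y ≤ r}) := by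
  set δ := ⨆ x : X, (∑' y, b x y) / m x with hδ
  set mm := ⨆ x : X, m x with hmm
  set c := ⨆ p : X × X, b p.1 p.2 with hcdef
  have x0 : X := Classical.arbitrary X
  have hmle : ∀ x, m x ≤ mm := fun x => le_ciSup hM x
  have hmm0 : 0 ≤ mm := (hm_pos x0).le.trans (hmle x0)
  have hδle : ∀ x, (∑' y, b x y) / m x ≤ δ := fun x => le_ciSup hB x
  have hδ0 : 0 ≤ δ :=
    (div_nonneg (tsum_nonneg (hb_nonneg x0)) (hm_pos x0).le).trans (hδle x0)
  have hdeg : ∀ x, ∑' y, b x y ≤ δ * mm := by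
    intro x
    have h := hδle x
    rw [div_le_iff₀ (hm_pos x)] at h
    exact h.trans (mul_le_mul_of_nonneg_left (hmle x) hδ0)
  have hbb : BddAbove (Set.range fun p : X × X => b p.1 p.2) := by
    refine ⟨δ * mm, ?_⟩
    rintro _ ⟨p, rfl⟩
    exact ((hb_sum p.1).le_tsum p.2 (fun y _ => hb_nonneg p.1 y)).trans (hdeg p.1)
  have hc : ∀ x y, b x y ≤ c := fun x y => le_ciSup hbb (x, y)
  have hc0 : 0 ≤ c := (hb_nonneg x0 x0).trans (hc x0 x0)
  have main : ∀ r : ℝ, 0 ≤ r → ∀ x : X, {y | graphDist b x y ≤ r}.Finite ∧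
      ({y | graphDist b x y ≤ r}.ncard : ℝ) ≤ (r * δ * mm) ^ (r * c) + 1 := by
    intro r hr x
    rw [mul_assoc]
    exact ball_bound b hb_symm hb_nonneg hb_sum hconn (δ * mm) c hdeg hc (by positivity) hc0 r hr x
  refine ⟨main, ?_⟩
  intro r hr
  refine ⟨((r * δ * mm) ^ (r * c) + 1) * mm, ?_⟩
  rintro _ ⟨x, rfl⟩
  obtain ⟨hf, hcard⟩ := main r hr x
  simp only [vol]
  have := hf.fintype
  rw [tsum_fintype]
  refine (Finset.sum_le_card_nsmul Finset.univ (fun y : {y | graphDist b x y ≤ r} => m (y : X)) mm (fun y _ => hmle (y : X))).trans ?_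
  rw [nsmul_eq_mul, Finset.card_univ, ← Nat.card_eq_fintype_card, Nat.card_coe_set_eq]
  exact mul_le_mul_of_nonneg_right hcard hmm0
end

section
/- Let (X,b,m) be a connected weighted graph satisfying (B) and (M), and let Ω ⊂ X be nonempty with Ω ≠ X, vol(Ω) < ∞ and Inr(Ω) < ∞. Then the bottom of the spectrum of the Dirichlet Laplacian satisfies λ_Ω ≥ 1/(Inr(Ω)·vol(Ω)). Equivalently, ‖f‖² ≤ Inr(Ω)·vol(Ω)·E(f,f) for every f ∈ ℓ²(X,m) vanishing on X∖Ω. -/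
/-! Basic notions for a weighted graph `(X, b, m)`:
`b : X × X → [0,∞)` is a symmetric edge weight, `m : X → (0,∞)` a vertex measure.
Paths, path lengths, the induced path metric `graphDist`, the energy form,
`ℓ²(X,m)`, volumes, inradius and covering radius. -/

variable {X : Type*}

namespace S5

/-- Sum of edge energies along a path. -/
noncomputable def pathEnergy (b : X → X → ℝ) (f : X → ℝ) : List X → ℝ
  | [] => 0
  | [_] => 0
  | u :: v :: rest => b u v * (f u - f v) ^ 2 + pathEnergy b f (v :: rest)

lemma pathLength_nonneg (b : X → X → ℝ) (hb : ∀ x y, 0 ≤ b x y) :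
    ∀ γ : List X, 0 ≤ pathLength b γ
  | [] => le_rfl
  | [_] => le_rfl
  | u :: v :: rest => by
    have := pathLength_nonneg b hb (v :: rest)
    have := hb u v
    simp only [pathLength]
    positivity

lemma pathEnergy_nonneg (b : X → X → ℝ) (hb : ∀ x y, 0 ≤ b x y) (f : X → ℝ) :
    ∀ γ : List X, 0 ≤ pathEnergy b f γ
  | [] => le_rfl
  | [_] => le_rfl
  | u :: v :: rest => by
    have := pathEnergy_nonneg b hb f (v :: rest)
    have := hb u v
    simp only [pathEnergy]
    positivity

lemma pathLength_suffix (b : X → X → ℝ) (hb : ∀ x y, 0 ≤ b x y) (t : List X) :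
    ∀ s : List X, pathLength b t ≤ pathLength b (s ++ t)
  | [] => le_rfl
  | [a] => by
    cases t with
    | nil => simp [pathLength]
    | cons v r =>
      have := hb a v
      simp only [List.cons_append, List.nil_append, pathLength]
      have : 0 ≤ 1 / b a v := by positivity
      linarith
  | u :: v :: rest => by
    have h := pathLength_suffix b hb t (v :: rest)
    have := hb u v
    simp only [List.cons_append, pathLength] at h ⊢
    have : 0 ≤ 1 / b u v := by positivity
    linarith

lemma exists_nodup (b : X → X → ℝ) (hb : ∀ x y, 0 ≤ b x y) (y : X) :
    ∀ (γ : List X) (x : X), IsPathFrom b γ x y →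
      ∃ γ', IsPathFrom b γ' x y ∧ γ'.Nodup ∧ pathLength b γ' ≤ pathLength b γ
  | [], x, h => absurd rfl h.1.1
  | [a], x, h => ⟨[a], h, by simp, le_rfl⟩
  | u :: v :: rest, x, h => by
    obtain ⟨⟨_, hc⟩, hh, hl⟩ := h
    have hux : u = x := by simpa using hh
    subst hux
    have hc' := List.isChain_cons_cons.1 hc
    obtain ⟨γ', ⟨⟨hn, hch⟩, hhd, hlst⟩, hnd, hlen⟩ := exists_nodup b hb y (v :: rest) v
      ⟨⟨by simp, hc'.2⟩, by simp, by simpa using hl⟩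
    have hbuv : 0 ≤ 1 / b u v := by have := hb u v; positivity
    by_cases hu : u ∈ γ'
    · obtain ⟨s, t, rfl⟩ := List.append_of_mem hu
      refine ⟨u :: t, ⟨⟨by simp, ?_⟩, by simp, ?_⟩, ?_, ?_⟩
      · exact (List.isChain_append.1 hch).2.1
      · simpa using hlst
      · exact (List.nodup_append.1 hnd).2.1
      · have := pathLength_suffix b hb (u :: t) s
        simp only [pathLength]
        linarith
    · cases γ' with
      | nil => exact absurd rfl hn
      | cons w t =>
        have hw : w = v := by simpa using hhd
        subst hw
        refine ⟨u :: w :: t, ⟨⟨by simp, ?_⟩, by simp, ?_⟩, ?_, ?_⟩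
        · exact List.isChain_cons_cons.2 ⟨hc'.1, hch⟩
        · simpa using hlst
        · exact List.nodup_cons.2 ⟨hu, hnd⟩
        · simp only [pathLength]
          linarith

lemma cs (b : X → X → ℝ) (hb : ∀ x y, 0 ≤ b x y) (f : X → ℝ) (y : X) :
    ∀ (γ : List X) (x : X), IsPathFrom b γ x y →
      (f x - f y) ^ 2 ≤ pathLength b γ * pathEnergy b f γ
  | [], x, h => absurd rfl h.1.1
  | [a], x, h => by
    have h1 : a = x := by simpa using h.2.1
    have h2 : a = y := by simpa using h.2.2
    subst h1; subst h2
    simp [pathLength]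
  | u :: v :: rest, x, h => by
    obtain ⟨⟨_, hc⟩, hh, hl⟩ := h
    have hux : u = x := by simpa using hh
    subst hux
    have hc' := List.isChain_cons_cons.1 hc
    have ih := cs b hb f y (v :: rest) v
      ⟨⟨by simp, hc'.2⟩, by simp, by simpa using hl⟩
    have hL := pathLength_nonneg b hb (v :: rest)
    have hQ := pathEnergy_nonneg b hb f (v :: rest)
    have hB : 0 < b u v := hc'.1
    simp only [pathLength, pathEnergy]
    generalize pathLength b (v :: rest) = L at *
    generalize pathEnergy b f (v :: rest) = Q at *
    generalize b u v = B at *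
    have e1 : f u - f y = (f u - f v) + (f v - f y) := by ring
    rw [e1]
    generalize f u - f v = a at *
    generalize f v - f y = c at *
    have e2 : (1 / B + L) * (B * a ^ 2 + Q) = a ^ 2 + (L * B * a ^ 2 + Q / B) + L * Q := by
      field_simp
      ring
    have h3 : (2 * (a * c)) ^ 2 ≤ (L * B * a ^ 2 + Q / B) ^ 2 := by
      have e3 : (L * B * a ^ 2) * (Q / B) = a ^ 2 * (L * Q) := by field_simp
      have := mul_le_mul_of_nonneg_left ih (sq_nonneg a)
      nlinarith [sq_nonneg (L * B * a ^ 2 - Q / B)]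
    have h5 : 2 * (a * c) ≤ L * B * a ^ 2 + Q / B :=
      (le_abs_self _).trans (abs_le_of_sq_le_sq h3 (by positivity))
    rw [e2]
    nlinarith

lemma two_energy (b : X → X → ℝ) (hb : ∀ x y, 0 ≤ b x y) (hs : ∀ x y, b x y = b y x)
    (f : X → ℝ) [DecidableEq X] :
    ∀ (γ : List X), γ.Nodup → 2 * pathEnergy b f γ ≤
      ∑ x ∈ γ.toFinset, ∑ y ∈ γ.toFinset, b x y * (f x - f y) ^ 2
  | [], _ => by simp [pathEnergy]
  | [a], _ => by simp [pathEnergy]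
  | u :: v :: rest, h => by
    obtain ⟨hu, hn⟩ := List.nodup_cons.1 h
    have ih := two_energy b hb hs f (v :: rest) hn
    have hv : v ∈ (v :: rest).toFinset := by simp
    have hu' : u ∉ (v :: rest).toFinset := by simpa using hu
    have hg : ∀ x y, 0 ≤ b x y * (f x - f y) ^ 2 := fun x y => by
      have := hb x y
      positivity
    rw [List.toFinset_cons]
    simp only [pathEnergy]
    generalize (v :: rest).toFinset = V at *
    simp only [Finset.sum_insert hu', Finset.sum_add_distrib]
    have h1 := Finset.single_le_sum (f := fun y => b u y * (f u - f y) ^ 2)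
      (fun y _ => hg u y) hv
    have h2 := Finset.single_le_sum (f := fun y => b y u * (f y - f u) ^ 2)
      (fun y _ => hg y u) hv
    have h0 := hg u u
    simp only [hs v u] at h2
    nlinarith

lemma summable_energy (b : X → X → ℝ) (m : X → ℝ)
    (hs : ∀ x y, b x y = b y x) (hb : ∀ x y, 0 ≤ b x y)
    (hb_sum : ∀ x, Summable fun y => b x y) (hm_pos : ∀ x, 0 < m x)
    (hB : BddAbove (Set.range fun x => (∑' y, b x y) / m x))
    (f : X → ℝ) (hf : MemL2 m f) :
    Summable fun p : X × X => b p.1 p.2 * (f p.1 - f p.2) ^ 2 := by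
  obtain ⟨δ, hδ⟩ := hB
  have h1 : Summable fun p : X × X => b p.1 p.2 * f p.1 ^ 2 := by
    have hnn : 0 ≤ fun p : X × X => b p.1 p.2 * f p.1 ^ 2 :=
      fun p => mul_nonneg (hb _ _) (sq_nonneg _)
    refine (summable_prod_of_nonneg hnn).2 ⟨?_, ?_⟩
    · intro x
      exact (hb_sum x).mul_right (f x ^ 2)
    · refine Summable.of_nonneg_of_le (fun x => tsum_nonneg fun y =>
        mul_nonneg (hb _ _) (sq_nonneg _)) (fun x => ?_) (Summable.mul_left δ hf)
      simp only [tsum_mul_right]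
      have h := hδ ⟨x, rfl⟩
      simp only at h
      rw [div_le_iff₀ (hm_pos x)] at h
      nlinarith [mul_le_mul_of_nonneg_right h (sq_nonneg (f x))]
  have h2 : Summable fun p : X × X => b p.1 p.2 * f p.2 ^ 2 := by
    have := (Equiv.prodComm X X).summable_iff.2 h1
    refine this.congr fun p => ?_
    simp [hs p.1 p.2]
  refine Summable.of_nonneg_of_le (fun p => mul_nonneg (hb _ _) (sq_nonneg _)) (fun p => ?_)
    ((h1.add h2).mul_left 2)
  nlinarith [mul_nonneg (hb p.1 p.2) (sq_nonneg (f p.1 + f p.2))]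

lemma path_bound (b : X → X → ℝ) (hs : ∀ x y, b x y = b y x) (hb : ∀ x y, 0 ≤ b x y)
    (f : X → ℝ) (hsum : Summable fun p : X × X => b p.1 p.2 * (f p.1 - f p.2) ^ 2)
    (x y : X) (γ : List X) (hγ : IsPathFrom b γ x y) :
    (f x - f y) ^ 2 ≤ pathLength b γ * energy b f := by
  classical
  obtain ⟨γ', h', hn, hl⟩ := exists_nodup b hb y γ x hγ
  have h1 := cs b hb f y γ' x h'
  have h2 := two_energy b hb hs f γ' hn
  rw [← Finset.sum_product'] at h2
  have h3 := hsum.sum_le_tsum (γ'.toFinset ×ˢ γ'.toFinset)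
    (fun p _ => mul_nonneg (hb _ _) (sq_nonneg _))
  have h4 : pathEnergy b f γ' ≤ energy b f := by
    unfold energy
    linarith
  have := pathEnergy_nonneg b hb f γ'
  have := pathLength_nonneg b hb γ'
  have := pathLength_nonneg b hb γ
  calc _ ≤ _ := h1
    _ ≤ _ := by gcongr

end S5

/-- Theorem 3.2 (a). Let `(X,b,m)` be a connected weighted
graph satisfying (B) and (M) and let `Ω ⊆ X` be nonempty, `Ω ≠ X`, with
`vol(Ω) < ∞` and `Inr(Ω) < ∞`. Then `λ_Ω ≥ 1/(Inr(Ω)·vol(Ω))`; equivalently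
(this is the form stated here) `‖f‖² ≤ Inr(Ω)·vol(Ω)·E(f,f)` for every
`f ∈ ℓ²(X,m)` vanishing on `X∖Ω`. -/
theorem statement_5 {X : Type*} [Countable X] [Nonempty X]
    (b : X → X → ℝ) (m : X → ℝ)
    (hb_symm : ∀ x y, b x y = b y x) (hb_nonneg : ∀ x y, 0 ≤ b x y)
    (hb_diag : ∀ x, b x x = 0) (hb_sum : ∀ x, Summable fun y => b x y)
    (hm_pos : ∀ x, 0 < m x)
    (hconn : ∀ x y, ∃ γ, IsPathFrom b γ x y)
    (hB : BddAbove (Set.range fun x => (∑' y, b x y) / m x))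
    (hM : BddAbove (Set.range m))
    (Ω : Set X) (hΩne : Ω.Nonempty) (hΩproper : Ω ≠ Set.univ)
    (hΩvol : Summable fun x : Ω => m (x : X))
    (hΩinr : BddAbove {r | 0 < r ∧ ∃ x ∈ Ω, ∀ y, graphDist b x y < r → y ∈ Ω}) :
    ∀ f : X → ℝ, MemL2 m f → (∀ x ∉ Ω, f x = 0) →
      l2norm m f ≤ inradius b Ω * vol m Ω * energy b f := by
  intro f hf hf0
  have hsum := S5.summable_energy b m hb_symm hb_nonneg hb_sum hm_pos hB f hf
  have hE : 0 ≤ energy b f := by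
    unfold energy
    exact mul_nonneg (by norm_num) (tsum_nonneg fun p => mul_nonneg (hb_nonneg _ _) (sq_nonneg _))
  have hI : 0 ≤ inradius b Ω := Real.sSup_nonneg fun r hr => hr.1.le
  have key : ∀ x ∈ Ω, f x ^ 2 ≤ inradius b Ω * energy b f := by
    intro x hx
    have hε : ∀ ε > 0, f x ^ 2 ≤ (inradius b Ω + ε) * energy b f := by
      intro ε hε
      have hnot : ¬ ∀ y, graphDist b x y < inradius b Ω + ε → y ∈ Ω := by
        intro hall
        have : inradius b Ω + ε ≤ inradius b Ω :=
          le_csSup hΩinr ⟨by linarith, x, hx, hall⟩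
        linarith
      push Not at hnot
      obtain ⟨y, hy, hyΩ⟩ := hnot
      obtain ⟨γ₀, hγ₀⟩ := hconn x y
      obtain ⟨L, ⟨γ, hγ, rfl⟩, hL⟩ := exists_lt_of_csInf_lt
        (s := {L | ∃ γ, IsPathFrom b γ x y ∧ L = pathLength b γ}) ⟨_, γ₀, hγ₀, rfl⟩ hy
      have h := S5.path_bound b hb_symm hb_nonneg f hsum x y γ hγ
      rw [hf0 y hyΩ, sub_zero] at h
      exact h.trans (mul_le_mul_of_nonneg_right hL.le hE)
    have ht : Filter.Tendsto (fun ε : ℝ => (inradius b Ω + ε) * energy b f)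
        (nhdsWithin 0 (Set.Ioi 0)) (nhds ((inradius b Ω + 0) * energy b f)) := by
      apply Filter.Tendsto.mono_left _ nhdsWithin_le_nhds
      exact Continuous.tendsto (by fun_prop) 0
    rw [add_zero] at ht
    exact ge_of_tendsto ht (Filter.eventually_of_mem self_mem_nhdsWithin hε)
  have hsupp : Function.support (fun x => f x ^ 2 * m x) ⊆ Ω := by
    intro x hx
    by_contra hxΩ
    exact hx (by simp [hf0 x hxΩ])
  unfold l2norm vol
  rw [← tsum_subtype_eq_of_support_subset hsupp, mul_right_comm, ← tsum_mul_left]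
  refine Summable.tsum_le_tsum (fun x => ?_) (hf.subtype Ω) (hΩvol.mul_left _)
  exact mul_le_mul_of_nonneg_right (key x x.2) (hm_pos _).le
end

section
/- Let (X,b,m) be a connected weighted graph satisfying (B) and (M), and let Ω ⊂ X be nonempty with Ω ≠ X and vol(Ω) < ∞. If additionally vol(X) < ∞, then λ_Ω ≤ ‖H‖·(vol(X) − vol(Ω))/vol(X), where H is the weighted Laplacian on ℓ²(X,m). -/
/-! Basic notions for a weighted graph `(X, b, m)`:
`b : X × X → [0,∞)` is a symmetric edge weight, `m : X → (0,∞)` a vertex measure.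
Paths, path lengths, the induced path metric `graphDist`, the energy form,
`ℓ²(X,m)`, volumes, inradius and covering radius. -/

variable {X : Type*}

/-- The bottom of the spectrum of the Dirichlet Laplacian `H_Ω` on
`ℓ²(Ω,m)` (Dirichlet boundary conditions on `X∖Ω`), via the variational
characterization: the infimum of the Rayleigh quotients `E(f,f)/‖f‖²` over
nonzero `f ∈ ℓ²(X,m)` vanishing outside `Ω`. -/
noncomputable def dirichletLambda (b : X → X → ℝ) (m : X → ℝ) (Ω : Set X) : ℝ :=
  sInf {r | ∃ f : X → ℝ, MemL2 m f ∧ f ≠ 0 ∧ (∀ x ∉ Ω, f x = 0) ∧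
    r = energy b f / l2norm m f}

/-- The operator norm `‖H‖` of the (nonnegative, selfadjoint) weighted
Laplacian `H`, via its variational characterization
`‖H‖ = sup E(f,f)/‖f‖²`. -/
noncomputable def lapNorm (b : X → X → ℝ) (m : X → ℝ) : ℝ :=
  sSup {r | ∃ f : X → ℝ, MemL2 m f ∧ f ≠ 0 ∧ r = energy b f / l2norm m f}

theorem aux_l2_pos (m : X → ℝ) (hm_pos : ∀ x, 0 < m x) (f : X → ℝ) (hf : MemL2 m f)
    (h0 : f ≠ 0) : 0 < l2norm m f := by
  obtain ⟨x, hx⟩ := Function.ne_iff.mp h0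
  have hx' : f x ≠ 0 := hx
  exact hf.tsum_pos (fun y => mul_nonneg (sq_nonneg _) (hm_pos y).le) x
    (mul_pos (by positivity) (hm_pos x))

theorem aux_energy_le (b : X → X → ℝ) (m : X → ℝ)
    (hb_symm : ∀ x y, b x y = b y x) (hb_nonneg : ∀ x y, 0 ≤ b x y)
    (hb_sum : ∀ x, Summable fun y => b x y) (hm_pos : ∀ x, 0 < m x) (δ : ℝ)
    (hδ : ∀ x, (∑' y, b x y) / m x ≤ δ) (f : X → ℝ) (hf : MemL2 m f) :
    energy b f ≤ 2 * δ * l2norm m f := by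
  have hle : ∀ x, ∑' y, b x y * f x ^ 2 ≤ δ * (f x ^ 2 * m x) := by
    intro x
    rw [tsum_mul_right]
    have := (div_le_iff₀ (hm_pos x)).mp (hδ x)
    nlinarith [mul_le_mul_of_nonneg_right this (sq_nonneg (f x))]
  have hF0 : 0 ≤ fun p : X × X => b p.1 p.2 * f p.1 ^ 2 :=
    fun p => mul_nonneg (hb_nonneg _ _) (sq_nonneg _)
  have hs2 : Summable fun x => ∑' y, b x y * f x ^ 2 :=
    Summable.of_nonneg_of_le (fun x => tsum_nonneg fun y => hF0 (x, y)) hle (hf.mul_left δ)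
  have hF : Summable fun p : X × X => b p.1 p.2 * f p.1 ^ 2 :=
    (summable_prod_of_nonneg hF0).mpr ⟨fun x => (hb_sum x).mul_right (f x ^ 2), hs2⟩
  have hG : Summable fun p : X × X => b p.1 p.2 * f p.2 ^ 2 := by
    have := (Equiv.prodComm X X).summable_iff.mpr hF
    refine this.congr fun p => ?_
    simp [hb_symm p.2 p.1]
  have hGF : ∑' p : X × X, b p.1 p.2 * f p.2 ^ 2 = ∑' p : X × X, b p.1 p.2 * f p.1 ^ 2 := by
    rw [← (Equiv.prodComm X X).tsum_eq]
    refine tsum_congr fun p => ?_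
    simp [hb_symm p.2 p.1]
  have hFle : ∑' p : X × X, b p.1 p.2 * f p.1 ^ 2 ≤ δ * l2norm m f := by
    rw [hF.tsum_prod, l2norm, ← tsum_mul_left]
    exact hs2.tsum_le_tsum hle (hf.mul_left δ)
  have hpt : ∀ p : X × X, b p.1 p.2 * (f p.1 - f p.2) ^ 2
      ≤ 2 * (b p.1 p.2 * f p.1 ^ 2 + b p.1 p.2 * f p.2 ^ 2) := by
    intro p
    nlinarith [mul_nonneg (hb_nonneg p.1 p.2) (sq_nonneg (f p.1 + f p.2))]
  have hS := (hF.add hG).mul_left 2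
  have h1 := Summable.tsum_le_tsum hpt
    (Summable.of_nonneg_of_le (fun p => mul_nonneg (hb_nonneg _ _) (sq_nonneg _)) hpt hS) hS
  rw [tsum_mul_left, hF.tsum_add hG, hGF] at h1
  unfold energy
  linarith

/-- Theorem 3.2 (b). Let `(X,b,m)` be a connected weighted
graph satisfying (B) and (M), `Ω ⊆ X` nonempty with `Ω ≠ X` and
`vol(Ω) < ∞`. If moreover `vol(X) < ∞` then
`λ_Ω ≤ ‖H‖·(vol(X) − vol(Ω))/vol(X)`. -/
theorem statement_6 {X : Type*} [Countable X] [Nonempty X]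
    (b : X → X → ℝ) (m : X → ℝ)
    (hb_symm : ∀ x y, b x y = b y x) (hb_nonneg : ∀ x y, 0 ≤ b x y)
    (hb_diag : ∀ x, b x x = 0) (hb_sum : ∀ x, Summable fun y => b x y)
    (hm_pos : ∀ x, 0 < m x)
    (hconn : ∀ x y, ∃ γ, IsPathFrom b γ x y)
    (hB : BddAbove (Set.range fun x => (∑' y, b x y) / m x))
    (hM : BddAbove (Set.range m))
    (Ω : Set X) (hΩne : Ω.Nonempty) (hΩproper : Ω ≠ Set.univ)
    (hΩvol : Summable fun x : Ω => m (x : X))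
    (hXvol : Summable m) :
    dirichletLambda b m Ω ≤
      lapNorm b m * (vol m Set.univ - vol m Ω) / vol m Set.univ := by
  classical
  obtain ⟨δ, hδ⟩ := hB
  have hδ' : ∀ x, (∑' y, b x y) / m x ≤ δ := fun x => hδ ⟨x, rfl⟩
  have hVu : vol m Set.univ = ∑' x, m x := tsum_univ m
  have hVΩ : vol m Ω = ∑' x, Ω.indicator m x := tsum_subtype Ω m
  have hind : Summable (Ω.indicator m) := hXvol.indicator Ω
  obtain ⟨x0, hx0⟩ := hΩne
  obtain ⟨y0, hy0⟩ := (Set.ne_univ_iff_exists_notMem Ω).mp hΩproper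
  set V := vol m Set.univ with hV
  set W := vol m Ω with hW
  have hVpos : 0 < V := by
    rw [hVu]; exact hXvol.tsum_pos (fun x => (hm_pos x).le) x0 (hm_pos x0)
  set f : X → ℝ := Ω.indicator 1 with hf
  have hfm : ∀ x, f x ^ 2 * m x = Ω.indicator m x := by
    intro x; by_cases h : x ∈ Ω <;> simp [hf, h]
  have hfL : MemL2 m f := hind.congr fun x => (hfm x).symm
  have hf0 : f ≠ 0 := fun h => by simpa [hf, hx0] using congrFun h x0
  have hfn : l2norm m f = W := by rw [hVΩ]; exact tsum_congr hfm
  have hWpos : 0 < W := hfn ▸ aux_l2_pos m hm_pos f hfL hf0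
  set t := W / V with ht
  set g : X → ℝ := fun x => f x - t with hg
  have hgm : ∀ x, g x ^ 2 * m x = (1 - 2 * t) * Ω.indicator m x + t ^ 2 * m x := by
    intro x
    by_cases h : x ∈ Ω
    · simp [hg, hf, h]; ring
    · simp [hg, hf, h]
  have hgL : MemL2 m g :=
    ((hind.mul_left _).add (hXvol.mul_left _)).congr fun x => (hgm x).symm
  have hgn : l2norm m g = (1 - 2 * t) * W + t ^ 2 * V := by
    rw [hVΩ, hVu, ← tsum_mul_left, ← tsum_mul_left,
      ← (hind.mul_left _).tsum_add (hXvol.mul_left _)]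
    exact tsum_congr hgm
  have hg0 : g ≠ 0 := fun h => by
    have := congrFun h y0
    have htp : 0 < t := div_pos hWpos hVpos
    simp [hg, hf, hy0] at this
    linarith
  have hE : energy b g = energy b f := by simp [energy, hg]
  have hgpos := aux_l2_pos m hm_pos g hgL hg0
  have h1 : energy b g / l2norm m g ≤ lapNorm b m := by
    refine le_csSup ⟨2 * δ, ?_⟩ ⟨g, hgL, hg0, rfl⟩
    rintro r ⟨u, hu, hu0, rfl⟩
    rw [div_le_iff₀ (aux_l2_pos m hm_pos u hu hu0)]
    exact aux_energy_le b m hb_symm hb_nonneg hb_sum hm_pos δ hδ' u hu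
  have h2 : dirichletLambda b m Ω ≤ energy b f / l2norm m f := by
    refine csInf_le ⟨0, ?_⟩ ⟨f, hfL, hf0, fun x hx => by simp [hf, hx], rfl⟩
    rintro r ⟨u, hu, hu0, -, rfl⟩
    refine div_nonneg (mul_nonneg (by norm_num) (tsum_nonneg fun p =>
      mul_nonneg (hb_nonneg _ _) (sq_nonneg _))) (aux_l2_pos m hm_pos u hu hu0).le
  refine h2.trans ?_
  rw [div_le_iff₀ hgpos, hE] at h1
  rw [hfn, div_le_iff₀ hWpos]
  refine h1.trans (le_of_eq ?_)
  rw [hgn, ht]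
  field_simp
  ring
end

section
/- Let (X,E) be a connected combinatorial graph with uniformly bounded vertex degree, let D ⊂ X be relatively dense with covering radius R := Covr(D) < ∞, and set Ω := X∖D. Then the isoperimetric constant of Ω satisfies β_Ω := inf{#∂S / #S : ∅ ≠ S ⊂ Ω, #S < ∞} ≥ 1/vol[R], where vol[R] := sup_{x∈X} #B_R(x). -/
variable {X : Type*}

/-- The combinatorial boundary of `S ⊆ X`:
`∂S = {(x,y) : x ∈ S, y ∉ S, x ~ y}`. -/
def combBoundary (G : SimpleGraph X) (S : Set X) : Set (X × X) :=
  {q : X × X | q.1 ∈ S ∧ q.2 ∉ S ∧ G.Adj q.1 q.2}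

/-- The covering radius `Covr(D) = inf {R > 0 : ⋃_{p ∈ D} B_R(p) = X}` for the
combinatorial graph metric. -/
noncomputable def combCovRad (G : SimpleGraph X) (D : Set X) : ℝ :=
  sInf {R : ℝ | 0 < R ∧ ∀ x, ∃ p ∈ D, (G.dist p x : ℝ) ≤ R}

theorem aux_exit (G : SimpleGraph X) (hconn : G.Connected) (S : Set X) {x p : X}
    (w : G.Walk x p) : x ∈ S → p ∉ S →
    ∃ q ∈ combBoundary G S, G.dist x q.1 ≤ w.length := by
  induction w with
  | nil => intro h1 h2; exact absurd h1 h2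
  | @cons u v t h w ih =>
    intro h1 h2
    by_cases hv : v ∈ S
    · obtain ⟨q, hq, hd⟩ := ih hv h2
      refine ⟨q, hq, ?_⟩
      have h3 : G.dist u q.1 ≤ G.dist u v + G.dist v q.1 := hconn.dist_triangle
      have h4 : G.dist u v = 1 := SimpleGraph.dist_eq_one_iff_adj.2 h
      rw [SimpleGraph.Walk.length_cons]
      omega
    · exact ⟨(u, v), ⟨h1, hv, h⟩, by simp⟩

theorem aux_ball (G : SimpleGraph X) (hconn : G.Connected)
    (hfin : ∀ x, (G.neighborSet x).Finite)
    (δ : ℕ) (hdeg : ∀ x, (G.neighborSet x).ncard ≤ δ) (n : ℕ) :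
    ∃ C : ℕ, ∀ x, ∃ t : Finset X, t.card ≤ C ∧ ∀ y, G.dist x y ≤ n → y ∈ t := by
  classical
  induction n with
  | zero =>
    refine ⟨1, fun x => ⟨{x}, by simp, fun y hy => ?_⟩⟩
    have h0 : x = y := hconn.dist_eq_zero_iff.1 (by omega)
    simp [h0]
  | succ n ih =>
    obtain ⟨C, hC⟩ := ih
    choose t ht hmem using hC
    refine ⟨C + δ * C, fun x => ⟨t x ∪ (hfin x).toFinset.biUnion t, ?_, fun y hy => ?_⟩⟩
    · refine (Finset.card_union_le _ _).trans (Nat.add_le_add (ht x) ?_)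
      refine (Finset.card_biUnion_le_card_mul _ _ C (fun a _ => ht a)).trans ?_
      refine Nat.mul_le_mul_right _ ?_
      rw [← Set.ncard_eq_toFinset_card _ (hfin x)]
      exact hdeg x
    · obtain ⟨w, hw⟩ := hconn.exists_walk_length_eq_dist x y
      cases w with
      | nil => exact Finset.mem_union_left _ (hmem _ _ (by simp))
      | @cons _ v _ h w =>
        refine Finset.mem_union_right _ (Finset.mem_biUnion.2 ⟨v, by simpa using h, hmem _ _ ?_⟩)
        have := SimpleGraph.dist_le w
        rw [SimpleGraph.Walk.length_cons] at hw
        omega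

/-- Proposition 6.2. Let `(X,E)` be a connected
combinatorial graph with uniformly bounded vertex degree, `D ⊆ X` relatively
dense with covering radius `R := Covr(D) < ∞` and `Ω := X∖D`. Then the
isoperimetric constant of `Ω` satisfies `β_Ω ≥ 1/vol[R]`, i.e. every nonempty
finite `S ⊆ Ω` satisfies `#∂S/#S ≥ 1/vol[R]`, where
`vol[R] = sup_x #B_R(x)`. -/
theorem statement_18 [Countable X] [Nonempty X]
    (G : SimpleGraph X)
    (hconn : G.Connected)
    (hfin : ∀ x, (G.neighborSet x).Finite)
    (hdeg : ∃ δ : ℕ, ∀ x, (G.neighborSet x).ncard ≤ δ)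
    (D : Set X)
    (hD : {R : ℝ | 0 < R ∧ ∀ x, ∃ p ∈ D, (G.dist p x : ℝ) ≤ R}.Nonempty) :
    ∀ S : Set X, S ⊆ Dᶜ → S.Finite → S.Nonempty →
      1 / (⨆ x : X, (({y | (G.dist x y : ℝ) ≤ combCovRad G D}.ncard : ℝ))) ≤
        ((combBoundary G S).ncard : ℝ) / (S.ncard : ℝ) := by
  classical
  intro S hSD hSfin hSne
  obtain ⟨δ, hδ⟩ := hdeg
  have hR0 : 0 ≤ combCovRad G D := le_csInf hD (fun r hr => hr.1.le)
  -- the covering radius is attained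
  have hcov : ∀ x, ∃ p ∈ D, (G.dist p x : ℝ) ≤ combCovRad G D := by
    intro x
    have hex : ∃ n : ℕ, ∃ p ∈ D, G.dist p x = n := by
      obtain ⟨r, _, hr⟩ := hD
      obtain ⟨p, hp, _⟩ := hr x
      exact ⟨_, p, hp, rfl⟩
    obtain ⟨p, hp, hpn⟩ := Nat.find_spec hex
    refine ⟨p, hp, le_csInf hD ?_⟩
    rintro r ⟨_, hr⟩
    obtain ⟨p', hp', hr'⟩ := hr x
    refine le_trans ?_ hr'
    rw [hpn]
    exact_mod_cast Nat.find_min' hex ⟨p', hp', rfl⟩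
  obtain ⟨C, hC⟩ := aux_ball G hconn hfin δ hδ ⌊combCovRad G D⌋₊
  choose t ht hmem using hC
  have hsub : ∀ x, {y | (G.dist x y : ℝ) ≤ combCovRad G D} ⊆ (t x : Set X) :=
    fun x y hy => hmem x y (Nat.le_floor hy)
  have hbfin : ∀ x, {y | (G.dist x y : ℝ) ≤ combCovRad G D}.Finite :=
    fun x => (t x).finite_toSet.subset (hsub x)
  have hbdd : BddAbove (Set.range fun x : X =>
      (({y | (G.dist x y : ℝ) ≤ combCovRad G D}.ncard : ℝ))) := by
    refine ⟨C, ?_⟩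
    rintro _ ⟨x, rfl⟩
    have h1 := Set.ncard_le_ncard (hsub x) (t x).finite_toSet
    rw [Set.ncard_coe_finset] at h1
    exact Nat.cast_le.2 (h1.trans (ht x))
  set V := ⨆ x : X, (({y | (G.dist x y : ℝ) ≤ combCovRad G D}.ncard : ℝ)) with hV
  have hle : ∀ x, ({y | (G.dist x y : ℝ) ≤ combCovRad G D}.ncard : ℝ) ≤ V :=
    fun x => le_ciSup hbdd x
  have hbd : (combBoundary G S).Finite := by
    refine (hSfin.prod (hSfin.biUnion fun x _ => hfin x)).subset ?_
    rintro ⟨a, b⟩ ⟨h1, h2, h3⟩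
    exact ⟨h1, Set.mem_biUnion h1 h3⟩
  have hcover : hSfin.toFinset ⊆ hbd.toFinset.biUnion (fun q => (hbfin q.1).toFinset) := by
    intro x hx
    have hx : x ∈ S := by simpa using hx
    obtain ⟨p, hp, hpx⟩ := hcov x
    obtain ⟨w, hw⟩ := hconn.exists_walk_length_eq_dist x p
    obtain ⟨q, hq, hd⟩ := aux_exit G hconn S w hx (fun h => hSD h hp)
    refine Finset.mem_biUnion.2 ⟨q, by simpa using hq, ?_⟩
    simp only [Set.Finite.mem_toFinset, Set.mem_ofPred_eq]
    refine le_trans ?_ hpx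
    rw [SimpleGraph.dist_comm, G.dist_comm (u := p), ← hw]
    exact_mod_cast hd
  have hmain : (S.ncard : ℝ) ≤ (combBoundary G S).ncard * V := by
    have h1 := (Finset.card_le_card hcover).trans Finset.card_biUnion_le
    rw [← Set.ncard_eq_toFinset_card _ hSfin] at h1
    have h2 : (S.ncard : ℝ) ≤
        ∑ q ∈ hbd.toFinset, ((hbfin q.1).toFinset.card : ℝ) := by exact_mod_cast h1
    refine h2.trans ?_
    rw [Set.ncard_eq_toFinset_card _ hbd, ← nsmul_eq_mul]
    refine Finset.sum_le_card_nsmul _ _ _ (fun q _ => ?_)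
    rw [← Set.ncard_eq_toFinset_card _ (hbfin q.1)]
    exact hle q.1
  have hSpos : (0 : ℝ) < S.ncard := by exact_mod_cast (Set.ncard_pos hSfin).2 hSne
  have hVpos : 0 < V := by
    by_contra hneg
    have : ((combBoundary G S).ncard : ℝ) * V ≤ 0 :=
      mul_nonpos_of_nonneg_of_nonpos (Nat.cast_nonneg _) (not_lt.1 hneg)
    linarith
  rw [div_le_div_iff₀ hVpos hSpos, one_mul]
  exact hmain
end
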